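/- Let α, β, γ have decidable equality and let S : α → β → Prop and T : β → γ → Prop be relations whose composition Comp S T is nonempty. If List.Forall₂ S xs us, remdupsLast us = remdupsLast vs, and List.Forall₂ T vs zs, then there exist lists xs' and zs' with remdupsLast xs = remdupsLast xs', List.Forall₂ (Comp S T) xs' zs', and remdupsLast zs' = remdupsLast zs. (Subdistributivity of the relator for distinct lists viewed as a quotient of lists.) -/

import Mathlib

/-- Composition of two relations. -/
def Comp {α β γ : Type*} (S : α → β → Prop) (T : β → γ → Prop) (a : α) (c : γ) : Prop :=
  ∃ b, S a b ∧ T b c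

/-- Keep only the last occurrence of each element. -/
def remdupsLast {α : Type*} [DecidableEq α] (l : List α) : List α :=
  l.reverse.dedup.reverse

theorem List.Forall₂.exists_rel_of_mem_left {α β : Type*} {R : α → β → Prop} {l : List α}
    {m : List β} (h : List.Forall₂ R l m) {a : α} (ha : a ∈ l) : ∃ b ∈ m, R a b := by
  induction h with
  | nil => simp at ha
  | cons hab _ ih =>
    rcases List.mem_cons.1 ha with rfl | ha
    · exact ⟨_, List.mem_cons_self, hab⟩
    · obtain ⟨b, hb, h⟩ := ih ha
      exact ⟨b, List.mem_cons_of_mem _ hb, h⟩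

theorem List.dedup_cons_congr {α : Type*} [DecidableEq α] {l m : List α} (a : α)
    (h : l.dedup = m.dedup) : (a :: l).dedup = (a :: m).dedup := by
  rw [List.dedup_cons', List.dedup_cons', h]

/-- Lists with equal `dedup` have a common expansion by duplicates of later entries, along which
`List.Forall₂` can be lifted on both sides. -/
theorem List.Forall₂.exists_common_expansion {α β γ : Type*}
    [DecidableEq α] [DecidableEq β] [DecidableEq γ]
    {S : α → β → Prop} {T : β → γ → Prop} {xs : List α} {us vs : List β} {zs : List γ}
    (hxu : List.Forall₂ S xs us) (huv : us.dedup = vs.dedup) (hvz : List.Forall₂ T vs zs) :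
    ∃ (xs' : List α) (ws : List β) (zs' : List γ), xs.dedup = xs'.dedup ∧
      List.Forall₂ S xs' ws ∧ us.dedup = ws.dedup ∧ List.Forall₂ T ws zs' ∧
      zs'.dedup = zs.dedup := by
  induction hxu generalizing vs zs with
  | nil =>
    obtain rfl : vs = [] := (List.dedup_eq_nil vs).1 huv.symm
    obtain rfl := List.forall₂_nil_left_iff.1 hvz
    exact ⟨[], [], [], rfl, .nil, rfl, .nil, rfl⟩
  | @cons x u xs us hxu hxus ih =>
    by_cases hu : u ∈ us
    · obtain ⟨xs', ws, zs', hxs, hS, hws, hT, hzs⟩ :=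
        ih ((List.dedup_cons_of_mem hu).symm.trans huv) hvz
      have huw : u ∈ ws := by rwa [← List.mem_dedup, ← hws, List.mem_dedup]
      obtain ⟨z, hz, huz⟩ := hT.exists_rel_of_mem_left huw
      exact ⟨x :: xs', u :: ws, z :: zs', List.dedup_cons_congr x hxs, .cons hxu hS,
        List.dedup_cons_congr u hws, .cons huz hT, (List.dedup_cons_of_mem hz).trans hzs⟩
    · induction hvz with
      | nil => simp [List.dedup_cons_of_notMem hu] at huv
      | @cons v z vs zs hvz hvzs ihv =>
        by_cases hv : v ∈ vs
        · obtain ⟨xs', ws, zs', hxs, hS, hws, hT, hzs⟩ :=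
            ihv (huv.trans (List.dedup_cons_of_mem hv))
          have hvw : v ∈ ws := by
            rw [← List.mem_dedup, ← hws, huv, List.mem_dedup]
            exact List.mem_cons_self
          obtain ⟨y, hy, hyv⟩ := hS.flip.exists_rel_of_mem_left hvw
          exact ⟨y :: xs', v :: ws, z :: zs', hxs.trans (List.dedup_cons_of_mem hy).symm,
            .cons hyv hS, hws.trans (List.dedup_cons_of_mem hvw).symm, .cons hvz hT,
            List.dedup_cons_congr z hzs⟩
        · rw [List.dedup_cons_of_notMem hu, List.dedup_cons_of_notMem hv] at huv
          obtain ⟨rfl, htail⟩ := List.cons.inj huv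
          obtain ⟨xs', ws, zs', hxs, hS, hws, hT, hzs⟩ := ih htail hvzs
          exact ⟨x :: xs', u :: ws, z :: zs', List.dedup_cons_congr x hxs, .cons hxu hS,
            List.dedup_cons_congr u hws, .cons hvz hT, List.dedup_cons_congr z hzs⟩

theorem List.Forall₂.comp {α β γ : Type*} {S : α → β → Prop} {T : β → γ → Prop}
    {xs : List α} {us : List β} {zs : List γ}
    (hS : List.Forall₂ S xs us) (hT : List.Forall₂ T us zs) :
    List.Forall₂ (Comp S T) xs zs := by
  induction hS generalizing zs with
  | nil => cases hT; exact .nil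
  | cons h _ ih =>
    cases hT with
    | cons h' hT => exact .cons ⟨_, h, h'⟩ (ih hT)

/-- Subdistributivity of the relator for distinct lists viewed as a quotient of lists. -/
theorem dlist_subdistributivity {α β γ : Type*}
    [DecidableEq α] [DecidableEq β] [DecidableEq γ]
    (S : α → β → Prop) (T : β → γ → Prop)
    (hne : ∃ a c, Comp S T a c)
    (xs : List α) (us vs : List β) (zs : List γ)
    (hxu : List.Forall₂ S xs us)
    (huv : remdupsLast us = remdupsLast vs)
    (hvz : List.Forall₂ T vs zs) :
    ∃ (xs' : List α) (zs' : List γ),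
      remdupsLast xs = remdupsLast xs' ∧
      List.Forall₂ (Comp S T) xs' zs' ∧
      remdupsLast zs' = remdupsLast zs := by
  obtain ⟨xs', ws, zs', hxs, hS, -, hT, hzs⟩ :=
    (List.rel_reverse hxu).exists_common_expansion (List.reverse_injective huv)
      (List.rel_reverse hvz)
  refine ⟨xs'.reverse, zs'.reverse, ?_, List.rel_reverse (hS.comp hT), ?_⟩
  · simp [remdupsLast, hxs]
  · simp [remdupsLast, hzs]
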